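/- Let g: ℝ^m → ℝ^q be twice continuously differentiable, Γ := {y ∈ ℝ^m | g(y) ≤ 0}, and suppose the metric subregularity constraint qualification holds for the system g(y) ≤ 0 at y ∈ Γ. Then for every y* ∈ N̂_Γ(y) with Λ(y, y*) ≠ ∅, the critical cone K(y, y*) := T_Γ(y) ∩ {y*}^⊥ is a convex polyhedron given by K(y, y*) = {v | ∇g(y)v ∈ T_{ℝ^q_-}(g(y)), ⟨v, y*⟩ = 0}, and moreover for any λ ∈ Λ(y, y*) one has K(y, y*) = {v | ∇g_i(y)v = 0 for all i with λ_i > 0, and ∇g_i(y)v ≤ 0 for all i with g_i(y) = 0 and λ_i = 0}. -/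

import Mathlib

open Filter Topology Set
open scoped RealInnerProductSpace

noncomputable section

/-- `ℝ^d` as a Euclidean space. -/
abbrev Eu (d : ℕ) := EuclideanSpace ℝ (Fin d)

/-- The (Bouligand–Severi) tangent/contingent cone to `Ω` at `z`. -/
def tcone {E : Type*} [NormedAddCommGroup E] [NormedSpace ℝ E] (Ω : Set E) (z : E) : Set E :=
  {u | ∃ t : ℕ → ℝ, ∃ w : ℕ → E, (∀ k, 0 < t k) ∧
    Tendsto t atTop (𝓝 0) ∧ Tendsto w atTop (𝓝 u) ∧ ∀ k, z + t k • w k ∈ Ω}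

/-- The (Fréchet) regular normal cone to `Ω` at `zb`. -/
def rnc {E : Type*} [NormedAddCommGroup E] [InnerProductSpace ℝ E]
    (Ω : Set E) (zb : E) : Set E :=
  {v | ∀ ε > (0 : ℝ), ∃ δ > (0 : ℝ), ∀ z ∈ Ω, ‖z - zb‖ < δ →
    ⟪v, z - zb⟫ ≤ ε * ‖z - zb‖}

/-- Metric subregularity of a set-valued map at a point of its graph. -/
def msr {E F : Type*} [NormedAddCommGroup E] [NormedAddCommGroup F]
    (M : E → Set F) (zb : E) (wb : F) : Prop :=
  ∃ κ : ℝ, 0 < κ ∧ ∃ W ∈ 𝓝 zb, ∀ z ∈ W,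
    EMetric.infEdist z {z' | wb ∈ M z'} ≤ ENNReal.ofReal κ * EMetric.infEdist wb (M z)

/-- The lower-level feasible set `Γ = {y | g(y) ≤ 0}`. -/
def Gam {m q : ℕ} (g : Eu m → Eu q) : Set (Eu m) := {y | ∀ i, g y i ≤ 0}

/-- The multiplier set `Λ(y, y*) = {λ ≥ 0 | ∇g(y)ᵀλ = y*, λ_i = 0 for i ∉ I(y)}`. -/
def Lam {m q : ℕ} (g : Eu m → Eu q) (y ys : Eu m) : Set (Eu q) :=
  {l | (∀ i, 0 ≤ l i) ∧ ContinuousLinearMap.adjoint (fderiv ℝ g y) l = ys ∧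
    ∀ i, g y i ≠ 0 → l i = 0}

/-- The critical cone `K(y, y*) = T_Γ(y) ∩ {y*}ᗮ`. -/
def Kcone {m q : ℕ} (g : Eu m → Eu q) (y ys : Eu m) : Set (Eu m) :=
  tcone (Gam g) y ∩ {v | ⟪v, ys⟫ = 0}

/-- The convex-analysis normal cone to a (convex) set `Ω` at `z`. -/
def cnc {E : Type*} [NormedAddCommGroup E] [InnerProductSpace ℝ E]
    (Ω : Set E) (z : E) : Set E :=
  {w | ∀ z' ∈ Ω, ⟪w, z' - z⟫ ≤ 0}

/-- `∇²(λᵀg)(y) v`, the Hessian of `y ↦ ⟨λ, g(y)⟩` applied to `v`, realized as the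
derivative at `y` of the gradient map `y' ↦ ∇g(y')ᵀλ` in the direction `v`. -/
def hessA {m q : ℕ} (g : Eu m → Eu q) (l : Eu q) (y v : Eu m) : Eu m :=
  fderiv ℝ (fun y' => ContinuousLinearMap.adjoint (fderiv ℝ g y') l) y v

/-- The directional multiplier set
`Λ(y, y*; v) = argmax {vᵀ∇²(λᵀg)(y)v | λ ∈ Λ(y, y*)}`. -/
def dirLam {m q : ℕ} (g : Eu m → Eu q) (y ys v : Eu m) : Set (Eu q) :=
  {l | l ∈ Lam g y ys ∧ ∀ l' ∈ Lam g y ys, ⟪v, hessA g l' y v⟫ ≤ ⟪v, hessA g l y v⟫}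

/-- The extreme points `E(y, y*)` of `Λ(y, y*)`: those multipliers `λ` for which the
active gradients `{∇g_i(y) | λ_i > 0}` are linearly independent. -/
def ExtPts {m q : ℕ} (g : Eu m → Eu q) (y ys : Eu m) : Set (Eu q) :=
  {l | l ∈ Lam g y ys ∧
    LinearIndependent ℝ (fun i : {i : Fin q // 0 < l i} =>
      fderiv ℝ (fun y' => g y' i.1) y)}

/-- The graph of the regular normal cone map `y ↦ N̂_Γ(y)`. -/
def gphN {m q : ℕ} (g : Eu m → Eu q) : Set (Eu m × Eu m) :=
  {p | p.1 ∈ Gam g ∧ p.2 ∈ rnc (Gam g) p.1}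

/-- MSCQ for the lower-level system `g(y) ≤ 0` at `yb`: metric subregularity of
`y ↦ g(y) − ℝ^q₋` at `(yb, 0)`. -/
def MSCQlow {m q : ℕ} (g : Eu m → Eu q) (yb : Eu m) : Prop :=
  msr (fun y => {w : Eu q | ∀ i, g y i - w i ≤ 0}) yb 0

/-- Directions tangent to `Γ` satisfy the linearized active constraints. -/
lemma fderiv_apply_nonpos_of_mem_tcone {m q : ℕ} {g : Eu m → Eu q} {y v : Eu m}
    (hg : DifferentiableAt ℝ g y) (hv : v ∈ tcone (Gam g) y) (i : Fin q) (hi : g y i = 0) :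
    fderiv ℝ g y v i ≤ 0 := by
  obtain ⟨t, w, ht, ht0, hw, hmem⟩ := hv
  have hlim := hg.hasFDerivAt.hasFDerivWithinAt (s := univ) |>.lim
    (d := fun k => t k • w k) (c := fun k => (t k)⁻¹) (l := atTop) (v := v)
    (by simpa using ht0.smul hw) (by simp)
    (by
      refine hw.congr fun k => ?_
      rw [smul_smul, inv_mul_cancel₀ (ht k).ne', one_smul])
  have hcoord : Continuous fun x : Eu q => x i := by fun_prop
  have hlim_i := (hcoord.tendsto _).comp hlim
  refine le_of_tendsto hlim_i (Eventually.of_forall fun k => ?_)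
  have := hmem k i
  change (t k)⁻¹ * (g (y + t k • w k) i - g y i) ≤ 0
  rw [hi, sub_zero]
  exact mul_nonpos_of_nonneg_of_nonpos (inv_nonneg.2 (ht k).le) this

/-- Under MSCQ, a linearized direction is approximated to first order by feasible points. -/
lemma MSCQlow.exists_mem_Gam_norm_sub_le {m q : ℕ} {g : Eu m → Eu q} {y v : Eu m}
    (hM : MSCQlow g y) (hg : DifferentiableAt ℝ g y) (hy : y ∈ Gam g)
    (hv : ∀ i, g y i = 0 → fderiv ℝ g y v i ≤ 0) {ε : ℝ} (hε : 0 < ε) :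
    ∃ t : ℝ, 0 < t ∧ t < ε ∧ ∃ z ∈ Gam g, ‖z - (y + t • v)‖ ≤ ε * t := by
  obtain ⟨κ, hκ, W, hW, hWκ⟩ := hM
  have hline : Tendsto (fun t : ℝ => y + t • v) (𝓝[>] 0) (𝓝 y) := by
    have : Continuous fun t : ℝ => y + t • v := by fun_prop
    simpa using (this.tendsto 0).mono_left nhdsWithin_le_nhds
  have hlinear : ∀ᶠ t : ℝ in 𝓝[>] 0, ∀ i, g y i + t * fderiv ℝ g y v i ≤ 0 := by
    refine eventually_all.2 fun i => ?_
    rcases (hy i).lt_or_eq with hi | hi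
    · have hc : Continuous fun t : ℝ => g y i + t * fderiv ℝ g y v i := by fun_prop
      have : Tendsto (fun t : ℝ => g y i + t * fderiv ℝ g y v i) (𝓝[>] 0) (𝓝 (g y i)) := by
        simpa using (hc.tendsto 0).mono_left nhdsWithin_le_nhds
      exact (this.eventually (gt_mem_nhds hi)).mono fun _ h => h.le
    · filter_upwards [self_mem_nhdsWithin] with t ht
      rw [hi, zero_add]
      exact mul_nonpos_of_nonneg_of_nonpos (le_of_lt ht) (hv i hi)
  have hremainder : ∀ᶠ t : ℝ in 𝓝[>] 0,
      ‖g (y + t • v) - g y - t • fderiv ℝ g y v‖ ≤ ε / (2 * κ) * t := by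
    have hd : HasDerivAt (fun t : ℝ => g (y + t • v)) (fderiv ℝ g y v) 0 :=
      hg.hasFDerivAt.hasLineDerivAt v
    have := (hasDerivAt_iff_isLittleO.1 hd).def (c := ε / (2 * κ)) (by positivity)
    filter_upwards [nhdsWithin_le_nhds this, self_mem_nhdsWithin] with t ht ht0
    simpa [abs_of_pos (show (0 : ℝ) < t from ht0)] using ht
  have hsmall : ∀ᶠ t : ℝ in 𝓝[>] 0, t < ε := nhdsWithin_le_nhds (gt_mem_nhds hε)
  obtain ⟨t, htW, htl, htr, htε, ht0⟩ := ((hline.eventually hW).and (hlinear.and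
    (hremainder.and (hsmall.and self_mem_nhdsWithin)))).exists
  replace ht0 : 0 < t := ht0
  refine ⟨t, ht0, htε, ?_⟩
  set r := g (y + t • v) - g y - t • fderiv ℝ g y v with hr
  have hrM : r ∈ {w : Eu q | ∀ i, g (y + t • v) i - w i ≤ 0} := fun i => by
    have := htl i
    simp only [hr, PiLp.sub_apply, PiLp.smul_apply, smul_eq_mul]
    linarith
  have hdist : Metric.infEDist (y + t • v) (Gam g) < ENNReal.ofReal (ε * t) := by
    have hGam : Gam g = {z | (0 : Eu q) ∈ {w : Eu q | ∀ i, g z i - w i ≤ 0}} := by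
      ext z
      simp [Gam]
    rw [hGam]
    calc _ ≤ ENNReal.ofReal κ * Metric.infEDist 0 {w : Eu q | ∀ i, g (y + t • v) i - w i ≤ 0} :=
          hWκ _ htW
      _ ≤ ENNReal.ofReal κ * ENNReal.ofReal (ε / (2 * κ) * t) := by
          gcongr
          refine (Metric.infEDist_le_edist_of_mem hrM).trans ?_
          rw [edist_dist, dist_zero_left]
          exact ENNReal.ofReal_le_ofReal htr
      _ = ENNReal.ofReal (ε * t / 2) := by
          rw [← ENNReal.ofReal_mul hκ.le]
          congr 1
          field_simp
      _ < ENNReal.ofReal (ε * t) :=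
          (ENNReal.ofReal_lt_ofReal_iff (by positivity)).2 (half_lt_self (by positivity))
  obtain ⟨z, hz, hzd⟩ := Metric.infEDist_lt_iff.1 hdist
  refine ⟨z, hz, ?_⟩
  rw [edist_dist, ENNReal.ofReal_lt_ofReal_iff (by positivity), dist_comm, dist_eq_norm] at hzd
  exact hzd.le

/-- Under MSCQ, the tangent cone to `Γ` equals the linearized cone. -/
lemma MSCQlow.mem_tcone_iff {m q : ℕ} {g : Eu m → Eu q} {y v : Eu m}
    (hM : MSCQlow g y) (hg : DifferentiableAt ℝ g y) (hy : y ∈ Gam g) :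
    v ∈ tcone (Gam g) y ↔ ∀ i, g y i = 0 → fderiv ℝ g y v i ≤ 0 := by
  refine ⟨fderiv_apply_nonpos_of_mem_tcone hg, fun hv => ?_⟩
  choose t ht0 htn z hz hzd using fun n : ℕ =>
    hM.exists_mem_Gam_norm_sub_le hg hy hv (Nat.one_div_pos_of_nat (α := ℝ) (n := n))
  have hlim := tendsto_one_div_add_atTop_nhds_zero_nat (𝕜 := ℝ)
  refine ⟨t, fun n => (t n)⁻¹ • (z n - y), ht0,
    squeeze_zero (fun n => (ht0 n).le) (fun n => (htn n).le) hlim, ?_, fun n => ?_⟩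
  · refine tendsto_iff_norm_sub_tendsto_zero.2
      (squeeze_zero (fun _ => norm_nonneg _) (fun n => ?_) hlim)
    have heq : (t n)⁻¹ • (z n - y) - v = (t n)⁻¹ • (z n - (y + t n • v)) := by
      rw [← sub_sub, smul_sub _ (z n - y), smul_smul, inv_mul_cancel₀ (ht0 n).ne', one_smul]
    rw [heq, norm_smul, norm_inv, Real.norm_of_nonneg (ht0 n).le, inv_mul_le_iff₀ (ht0 n),
      mul_comm]
    exact hzd n
  · rw [smul_smul, mul_inv_cancel₀ (ht0 n).ne', one_smul, add_sub_cancel]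
    exact hz n

/-- The pairing of a direction with `∇g(y)ᵀλ`, in coordinates. -/
lemma inner_eq_sum_of_mem_Lam {m q : ℕ} {g : Eu m → Eu q} {y ys : Eu m} {l : Eu q}
    (hl : l ∈ Lam g y ys) (v : Eu m) : ⟪v, ys⟫ = ∑ i, l i * fderiv ℝ g y v i := by
  rw [← hl.2.1, ContinuousLinearMap.adjoint_inner_right, PiLp.inner_apply]
  simp

/-- For a multiplier `λ`, orthogonality to `y*` within the linearized cone is complementarity
with `λ`. -/
lemma linearized_inner_eq_zero_iff {m q : ℕ} {g : Eu m → Eu q} {y ys : Eu m} {l : Eu q}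
    (hl : l ∈ Lam g y ys) (v : Eu m) :
    ((∀ i, g y i = 0 → fderiv ℝ g y v i ≤ 0) ∧ ⟪v, ys⟫ = 0) ↔
      (∀ i, 0 < l i → fderiv ℝ g y v i = 0) ∧
        ∀ i, g y i = 0 → l i = 0 → fderiv ℝ g y v i ≤ 0 := by
  have hact : ∀ i, 0 < l i → g y i = 0 := fun i hi => by
    by_contra h
    exact hi.ne' (hl.2.2 i h)
  rw [inner_eq_sum_of_mem_Lam hl]
  constructor
  · rintro ⟨hv, hsum⟩
    refine ⟨fun i hi => ?_, fun i hi _ => hv i hi⟩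
    have hterm : ∀ j ∈ Finset.univ, l j * fderiv ℝ g y v j ≤ 0 := fun j _ => by
      rcases (hl.1 j).eq_or_lt with hj | hj
      · simp [← hj]
      · exact mul_nonpos_of_nonneg_of_nonpos hj.le (hv j (hact j hj))
    have := (Finset.sum_eq_zero_iff_of_nonpos hterm).1 hsum i (Finset.mem_univ i)
    exact (mul_eq_zero.1 this).resolve_left hi.ne'
  · rintro ⟨heq, hle⟩
    refine ⟨fun i hi => ?_, Finset.sum_eq_zero fun i _ => ?_⟩
    · rcases (hl.1 i).eq_or_lt with h | h
      · exact hle i hi h.symm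
      · exact (heq i h).le
    · rcases (hl.1 i).eq_or_lt with h | h
      · simp [← h]
      · simp [heq i h]

/-- under MSCQ for `g(y) ≤ 0` at `y ∈ Γ`, for every regular normal
`y* ∈ N̂_Γ(y)` with `Λ(y, y*) ≠ ∅`, the critical cone `K(y, y*) = T_Γ(y) ∩ {y*}ᗮ` is
convex and is the polyhedron `{v | ∇g(y)v ∈ T_{ℝ^q₋}(g(y)), ⟨v, y*⟩ = 0}`; moreover for
any multiplier `λ ∈ Λ(y, y*)`,
`K(y, y*) = {v | ∇g_i(y)v = 0 (λ_i > 0), ∇g_i(y)v ≤ 0 (g_i(y) = 0, λ_i = 0)}`. -/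
theorem stmt_13 {m q : ℕ} (g : Eu m → Eu q) (hg : ContDiff ℝ 2 g)
    (y : Eu m) (hy : y ∈ Gam g) (hMSCQ : MSCQlow g y)
    (ys : Eu m) (hys : ys ∈ rnc (Gam g) y) (hLam : (Lam g y ys).Nonempty) :
    Convex ℝ (Kcone g y ys) ∧
    Kcone g y ys =
      {v | (∀ i, g y i = 0 → fderiv ℝ g y v i ≤ 0) ∧ ⟪v, ys⟫ = 0} ∧
    ∀ l ∈ Lam g y ys,
      Kcone g y ys =
        {v | (∀ i, 0 < l i → fderiv ℝ g y v i = 0) ∧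
             (∀ i, g y i = 0 → l i = 0 → fderiv ℝ g y v i ≤ 0)} := by
  have hd : DifferentiableAt ℝ g y := (hg.differentiable (by norm_num)) y
  have hK : Kcone g y ys =
      {v | (∀ i, g y i = 0 → fderiv ℝ g y v i ≤ 0) ∧ ⟪v, ys⟫ = 0} := by
    ext v
    exact and_congr_left fun _ => hMSCQ.mem_tcone_iff hd hy
  refine ⟨?_, hK, fun l hl => ?_⟩
  · rw [hK]
    rintro v ⟨hv, hv0⟩ w ⟨hw, hw0⟩ a b ha hb -
    refine ⟨fun i hi => ?_, ?_⟩
    · simp only [map_add, map_smul, PiLp.add_apply, PiLp.smul_apply, smul_eq_mul]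
      exact add_nonpos (mul_nonpos_of_nonneg_of_nonpos ha (hv i hi))
        (mul_nonpos_of_nonneg_of_nonpos hb (hw i hi))
    · rw [inner_add_left, real_inner_smul_left, real_inner_smul_left, hv0, hw0]
      simp
  · rw [hK]
    ext v
    exact linearized_inner_eq_zero_iff hl v
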